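/- Let R be a commutative ℚ-algebra equipped with pairwise commuting derivations ∂_1, …, ∂_h : R → R over ℚ, and let τ_1, …, τ_h ∈ R satisfy ∂_i(τ_m) = 1 if i = m and 0 otherwise. Let Z, τ03 ∈ R and u_1, …, u_h ∈ R satisfy u_m = −(1/2)·∂_m(Z) for all m and Z = τ03 − Σ_{m=1}^h τ_m·u_m. Then for all indices i, j, k: ∂_i∂_j∂_k(τ03) − Σ_{m=1}^h τ_m·∂_i∂_j∂_k(u_m) = −(1/2)·∂_i∂_j∂_k(Z). -/

import Mathlib

/-- Computational content of the cubic form of Bryant–Griffiths (Yukawa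
coupling): with commuting derivations `∂_i` dual to the flat coordinates
`τ_i`, `u_m = −(1/2)∂_m Z` and `Z = τ03 − Σ τ_m·u_m`, one has
`∂_i∂_j∂_k(τ03) − Σ_m τ_m·∂_i∂_j∂_k(u_m) = −(1/2)·∂_i∂_j∂_k(Z)`. -/
theorem stmt_15 (R : Type*) [CommRing R] [Algebra ℚ R] (h : ℕ)
    (D : Fin h → Derivation ℚ R R)
    (hcomm : ∀ i j : Fin h, ∀ x : R, D i (D j x) = D j (D i x))
    (τ : Fin h → R)
    (hτ : ∀ i m : Fin h, D i (τ m) = if i = m then 1 else 0)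
    (Z τ03 : R) (u : Fin h → R)
    (hu : ∀ m : Fin h, u m = (-(1/2) : ℚ) • D m Z)
    (hZ : Z = τ03 - ∑ m : Fin h, τ m * u m) :
    ∀ i j k : Fin h,
      D i (D j (D k τ03)) - ∑ m : Fin h, τ m * D i (D j (D k (u m))) =
        (-(1/2) : ℚ) • D i (D j (D k Z)) := by
  intro i j k
  have key : ∀ (a : Fin h) (f : Fin h → R),
      D a (∑ m : Fin h, τ m * f m) = f a + ∑ m : Fin h, τ m * D a (f m) := by
    intro a f
    simp [map_sum, Derivation.leibniz, hτ, Finset.sum_add_distrib, add_comm]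
  have h03 : τ03 = Z + ∑ m : Fin h, τ m * u m := by
    rw [← sub_eq_iff_eq_add]
    exact hZ.symm
  have e : D i (D j (D k τ03)) = D i (D j (D k Z)) + (D i (D j (u k)) +
      (D i (D k (u j)) + (D j (D k (u i)) +
        ∑ m : Fin h, τ m * D i (D j (D k (u m)))))) := by
    simp only [h03, map_add, key]
  have e1 : D i (D j (u k)) = (-(1/2) : ℚ) • D i (D j (D k Z)) := by
    rw [hu k, Derivation.map_smul, Derivation.map_smul]
  have e2 : D i (D k (u j)) = (-(1/2) : ℚ) • D i (D j (D k Z)) := by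
    rw [hu j, Derivation.map_smul, Derivation.map_smul, hcomm k j]
  have e3 : D j (D k (u i)) = (-(1/2) : ℚ) • D i (D j (D k Z)) := by
    rw [hu i, Derivation.map_smul, Derivation.map_smul, hcomm k i, hcomm j i]
  rw [e, e1, e2, e3]
  module
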